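/- Let α be a rewb over Σ, let p be a prefix of some string in Ref(α), and let i ∈ ℕ⁺. If p decomposes as p = x₀ b₁ x₁ b₂ x₂ ⋯ b_m x_m where each x_r contains neither [_i nor ]_i and each b_r ∈ {[_i, ]_i}, then b_r = [_i for every odd r and b_r = ]_i for every even r. -/

import Mathlib

namespace Rewbs

/-- Extended alphabet Δ = Σ ⊎ B ⊎ ℕ⁺ : ordinary characters, brackets `[_i`, `]_i`,
and number characters (references). -/
inductive RSym (A : Type) : Type where
  | ch : A → RSym A
  | open_ : ℕ+ → RSym A
  | close : ℕ+ → RSym A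
  | ref : ℕ+ → RSym A

/-- The alphabet Σ ⊎ B (no number characters). -/
inductive BSym (A : Type) : Type where
  | ch : A → BSym A
  | open_ : ℕ+ → BSym A
  | close : ℕ+ → BSym A

/-- The homomorphism g : (Σ ⊎ B)* → Σ* erasing brackets. -/
def projB {A : Type} (v : List (BSym A)) : List A :=
  v.filterMap fun c => match c with
    | .ch a => some a
    | _ => none

/-- The fetching function fet_i. -/
noncomputable def fet {A : Type} (i : ℕ+) (v : List (BSym A)) : List A :=
  letI : DecidableEq (BSym A) := Classical.decEq _
  if BSym.open_ i ∈ v then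
    projB (((v.reverse.takeWhile (fun c => decide (c ≠ BSym.open_ i))).reverse).takeWhile
      (fun c => decide (c ≠ BSym.close i)))
  else []

/-- One step of the pre-dereferencing function (processing one character, appended
at the right of the already-processed string). -/
noncomputable def derefStep {A : Type} (acc : List (BSym A)) : RSym A → List (BSym A)
  | .ch a => acc ++ [BSym.ch a]
  | .open_ i => acc ++ [BSym.open_ i]
  | .close i => acc ++ [BSym.close i]
  | .ref i => acc ++ (fet i acc).map BSym.ch

/-- The pre-dereferencing function D : Δ* → (Σ ⊎ B)*. -/
noncomputable def preDeref {A : Type} (v : List (RSym A)) : List (BSym A) :=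
  v.foldl derefStep []

/-- μ_i = fet_i ∘ D. -/
noncomputable def mu {A : Type} (i : ℕ+) (v : List (RSym A)) : List A :=
  fet i (preDeref v)

/-- deref = g ∘ D. -/
noncomputable def deref {A : Type} (v : List (RSym A)) : List A :=
  projB (preDeref v)

/-- One step of the `open` function. -/
def openStep {A : Type} (s : Finset ℕ+) : RSym A → Finset ℕ+
  | .open_ i => insert i s
  | .close i => s.erase i
  | _ => s

/-- open : Δ* → finite subsets of ℕ⁺. -/
def openSet {A : Type} (v : List (RSym A)) : Finset ℕ+ :=
  v.foldl openStep ∅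

/-- Syntax of regular expressions with backreferences (rewb). -/
inductive Rewb (A : Type) : Type where
  | ch : A → Rewb A
  | eps : Rewb A
  | backref : ℕ+ → Rewb A
  | cat : Rewb A → Rewb A → Rewb A
  | alt : Rewb A → Rewb A → Rewb A
  | star : Rewb A → Rewb A
  | grp : ℕ+ → Rewb A → Rewb A

/-- `hasIdx i α` : the capturing group `(_i )_i` or the reference `\i` occurs in α. -/
def hasIdx {A : Type} (i : ℕ+) : Rewb A → Prop
  | .ch _ => False
  | .eps => False
  | .backref j => j = i
  | .cat r s => hasIdx i r ∨ hasIdx i s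
  | .alt r s => hasIdx i r ∨ hasIdx i s
  | .star r => hasIdx i r
  | .grp j r => j = i ∨ hasIdx i r

/-- Well-formedness of a rewb: in `(_i α)_i`, the body α contains neither the
capturing group `(_i )_i` nor the reference `\i`. -/
def Rewb.WF {A : Type} : Rewb A → Prop
  | .ch _ => True
  | .eps => True
  | .backref _ => True
  | .cat r s => r.WF ∧ s.WF
  | .alt r s => r.WF ∧ s.WF
  | .star r => r.WF
  | .grp i r => r.WF ∧ ¬ hasIdx i r

/-- The ref-language Ref(α) ⊆ Δ*. -/
def Ref {A : Type} : Rewb A → Language (RSym A)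
  | .ch a => {[RSym.ch a]}
  | .eps => 1
  | .backref i => {[RSym.ref i]}
  | .cat r s => Ref r * Ref s
  | .alt r s => Ref r + Ref s
  | .star r => KStar.kstar (Ref r)
  | .grp i r => ({[RSym.open_ i]} : Language (RSym A)) * Ref r * ({[RSym.close i]} : Language (RSym A))

/-- The language of a rewb: L(α) = deref(Ref(α)). -/
noncomputable def rewbLang {A : Type} (r : Rewb A) : Set (List A) :=
  deref '' (Ref r : Set (List (RSym A)))

/-- capt(α): the set of indices guaranteed to be captured. -/
def capt {A : Type} : Rewb A → Set ℕ+
  | .ch _ => ∅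
  | .eps => ∅
  | .backref _ => ∅
  | .cat r s => capt r ∪ capt s
  | .alt r s => capt r ∩ capt s
  | .star r => capt r
  | .grp i r => capt r ∪ {i}

/-- The relation S ⊢ α. -/
def Sat {A : Type} : Rewb A → Set ℕ+ → Prop
  | .ch _, _ => True
  | .eps, _ => True
  | .backref i, S => i ∈ S
  | .cat r s, S => Sat r S ∧ Sat s (S ∪ capt r)
  | .alt r s, S => Sat r S ∧ Sat s S
  | .star r, S => Sat r S
  | .grp _ r, S => Sat r S

/-- A rewb is closed if ∅ ⊢ α. -/
def Rewb.Closed {A : Type} (r : Rewb A) : Prop := Sat r ∅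

/-- A rewb is closed-star if the body of every starred subexpression is closed. -/
def Rewb.ClosedStar {A : Type} : Rewb A → Prop
  | .ch _ => True
  | .eps => True
  | .backref _ => True
  | .cat r s => r.ClosedStar ∧ s.ClosedStar
  | .alt r s => r.ClosedStar ∧ s.ClosedStar
  | .star r => r.ClosedStar ∧ r.Closed
  | .grp _ r => r.ClosedStar

/-- All indices (number characters and capturing-group indices) occurring in α are ≤ κ. -/
def Rewb.IdxLe {A : Type} (κ : ℕ) : Rewb A → Prop
  | .ch _ => True
  | .eps => True
  | .backref i => (i : ℕ) ≤ κ
  | .cat r s => r.IdxLe κ ∧ s.IdxLe κ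
  | .alt r s => r.IdxLe κ ∧ s.IdxLe κ
  | .star r => r.IdxLe κ
  | .grp i r => (i : ℕ) ≤ κ ∧ r.IdxLe κ

/-- All indices occurring in a character of Δ are ≤ κ. -/
def RSym.idxLe {A : Type} (κ : ℕ) : RSym A → Prop
  | .ch _ => True
  | .open_ i => (i : ℕ) ≤ κ
  | .close i => (i : ℕ) ≤ κ
  | .ref i => (i : ℕ) ≤ κ

/-! ### The tuple functions φ used in the unary-PMCFG construction -/

/-- The ℕ⁺ index corresponding to `j : Fin κ` (memory cell j+1). -/
def toP {κ : ℕ} (j : Fin κ) : ℕ+ := ⟨j.1 + 1, Nat.succ_pos _⟩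

/-- φ_c^M : the input/paste/reset/identity functions on (κ+1)-tuples of strings. -/
def phi {A : Type} (κ : ℕ) (M : Finset ℕ+) :
    RSym A → (List A × (Fin κ → List A)) → (List A × (Fin κ → List A))
  | RSym.ch a, (x, y) => (x ++ [a], fun j => if toP j ∈ M then y j ++ [a] else y j)
  | RSym.ref k, (x, y) =>
      let yk : List A := if h : k.1 ≤ κ ∧ 1 ≤ k.1 then y ⟨k.1 - 1, by omega⟩ else []
      (x ++ yk, fun j => if toP j ∈ M then y j ++ yk else y j)
  | RSym.open_ k, (x, y) => (x, fun j => if toP j = k then [] else y j)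
  | RSym.close _, t => t

/-- Apply the functions φ_{v_r}^{open(prefix·v₁⋯v_r)} successively, left to right,
where `pref` is the already-processed prefix. -/
noncomputable def derefRun {A : Type} (κ : ℕ) :
    List (RSym A) → List (RSym A) → (List A × (Fin κ → List A)) → (List A × (Fin κ → List A))
  | _, [], t => t
  | pref, c :: rest, t => derefRun κ (pref ++ [c]) rest (phi κ (openSet (pref ++ [c])) c t)

/-! ### The quantities t and s -/

/-- One (right-to-left) step of the t-sequence. -/
def tStep {A : Type} (c : RSym A) (t : ℕ+ → ℕ) : ℕ+ → ℕ :=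
  match c with
  | .ch _ => t
  | .close _ => t
  | .open_ j => fun k => if k = j then 0 else t k
  | .ref j => fun k => if k = j then t k + 1 else t k

/-- `tOf suf k` is t_{i,k} where `suf` is the suffix v_{i+1} ⋯ v_m of v. -/
def tOf {A : Type} : List (RSym A) → ℕ+ → ℕ
  | [] => fun _ => 0
  | c :: rest => tStep c (tOf rest)

/-- One (right-to-left) step of the s-sequence; `O` is open(v₁⋯v_i). -/
def sStep {A : Type} (O : Finset ℕ+) (c : RSym A) (s : ℕ+ → ℕ) : ℕ+ → ℕ :=
  match c with
  | .ch _ => s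
  | .close _ => s
  | .open_ j => fun k => if k = j then 0 else s k
  | .ref j => fun k => if k = j then max (max 1 (s j)) (O.sup fun l => s l + 1) else s k

/-- `sOf pref suf k` is s_{i,k} where v = pref ++ suf and i = |pref|. -/
def sOf {A : Type} : List (RSym A) → List (RSym A) → ℕ+ → ℕ
  | _, [] => fun _ => 0
  | pref, c :: rest => sStep (openSet (pref ++ [c])) c (sOf (pref ++ [c]) rest)

/-! ### Parallel multiple context-free grammars -/

/-- An item of an output component of a PMCFG function: a constant string
or the j-th component of the i-th argument. -/
inductive PItem (T : Type) : Type where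
  | const : List T → PItem T
  | arg : ℕ → ℕ → PItem T

/-- A rule A → f[A₁,…,A_l] of a PMCFG, where f is given syntactically by the
lists of items of its output components. -/
structure PRule (T N : Type) : Type where
  lhs : N
  rhs : List N
  out : List (List (PItem T))

/-- A PMCFG with nonterminals `Fin n`. -/
structure PMCFG (T : Type) : Type where
  n : ℕ
  dim : Fin n → ℕ
  start : Fin n
  rules : List (PRule T (Fin n))

/-- Evaluation of a single item, given the tuples derived from the arguments. -/
def evalItem {T : Type} (args : List (List (List T))) : PItem T → List T
  | .const c => c
  | .arg i j => (args.getD i []).getD j []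

/-- Evaluation of one output component. -/
def evalItems {T : Type} (args : List (List (List T))) (items : List (PItem T)) : List T :=
  (items.map (evalItem args)).flatten

/-- The set L_G(A) of tuples derived from each nonterminal. -/
inductive PMCFG.Derives {T : Type} (G : PMCFG T) : Fin G.n → List (List T) → Prop
  | step (r : PRule T (Fin G.n)) (hr : r ∈ G.rules) (args : List (List (List T)))
      (hargs : List.Forall₂ G.Derives r.rhs args) :
      G.Derives r.lhs (r.out.map (evalItems args))

/-- L(G) = L_G(S), identifying 1-tuples with strings. -/
def PMCFG.lang {T : Type} (G : PMCFG T) : Set (List T) :=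
  {w | G.Derives G.start [w]}

/-- Well-formedness of a rule with respect to the dimension assignment. -/
def PRule.WFdim {T N : Type} (dim : N → ℕ) (r : PRule T N) : Prop :=
  r.out.length = dim r.lhs ∧
  ∀ items ∈ r.out, ∀ it ∈ items, ∀ i j, it = PItem.arg i j →
    ∃ h : i < r.rhs.length, j < dim (r.rhs.get ⟨i, h⟩)

/-- G is a well-formed m-PMCFG. -/
def PMCFG.WF {T : Type} (G : PMCFG T) (m : ℕ) : Prop :=
  (∀ A : Fin G.n, 1 ≤ G.dim A ∧ G.dim A ≤ m) ∧ G.dim G.start = 1 ∧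
  ∀ r ∈ G.rules, r.WFdim G.dim

/-- G is unary: every function takes at most one argument. -/
def PMCFG.Unary {T : Type} (G : PMCFG T) : Prop :=
  ∀ r ∈ G.rules, r.rhs.length ≤ 1

/-- The list of argument components referenced by a rule. -/
def PRule.argRefs {T N : Type} (r : PRule T N) : List (ℕ × ℕ) :=
  r.out.flatten.filterMap fun it => match it with
    | .arg i j => some (i, j)
    | _ => none

/-- G is an MCFG: no rule uses the same argument component more than once. -/
def PMCFG.NonDup {T : Type} (G : PMCFG T) : Prop :=
  ∀ r ∈ G.rules, r.argRefs.Nodup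

/-! ### Stack automata -/

/-- Direction of the stack pointer. -/
inductive SDir : Type where
  | left | stay | right
deriving DecidableEq

/-- A one-way nondeterministic stack automaton.  The input symbol `none`
denotes the endmarker ▷.  `push q a Z` is the pushdown mode (applicable when the
stack pointer is at the top symbol Z; the Bool is whether the input head moves
right); `read q a Z top` is the stack-reading mode (`top` tells whether the
pointed symbol Z is the topmost one). -/
structure SA (T : Type) : Type 1 where
  Q : Type
  finQ : Fintype Q
  Γ : Type
  finΓ : Fintype Γ
  q0 : Q
  Z0 : Γ
  F : Set Q
  push : Q → Option T → Γ → Set (Q × Bool × List Γ)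
  read : Q → Option T → Γ → Bool → Set (Q × Bool × SDir)

namespace SA

/-- Instantaneous description: state, remaining input (the endmarker ▷ is
implicit at the end), stack below-and-including the pointer, stack above the
pointer. -/
def Conf {T : Type} (M : SA T) : Type := M.Q × List T × List M.Γ × List M.Γ

/-- Move the stack pointer: the stack is γ ++ [Z] ++ above with the pointer on Z. -/
def moveStack {Γ : Type} : SDir → List Γ → Γ → List Γ → List Γ × List Γ
  | .left, γ, Z, above => (γ, Z :: above)
  | .stay, γ, Z, above => (γ ++ [Z], above)
  | .right, γ, Z, b :: rest => (γ ++ [Z, b], rest)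
  | .right, γ, Z, [] => (γ ++ [Z], [])

/-- One move of a stack automaton on instantaneous descriptions. -/
inductive Step {T : Type} (M : SA T) : M.Conf → M.Conf → Prop
  | push (q : M.Q) (u : List T) (γ : List M.Γ) (Z : M.Γ) (q' : M.Q) (d : Bool) (y : List M.Γ)
      (hmem : (q', d, y) ∈ M.push q u.head? Z)
      (hd : d = true → u ≠ []) :
      Step M (q, u, γ ++ [Z], []) (q', if d then u.tail else u, γ ++ y, [])
  | read (q : M.Q) (u : List T) (γ : List M.Γ) (Z : M.Γ) (above : List M.Γ)
      (q' : M.Q) (d : Bool) (e : SDir)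
      (hmem : (q', d, e) ∈ M.read q u.head? Z above.isEmpty)
      (hd : d = true → u ≠ [])
      (hleft : e = SDir.left → γ ≠ [])
      (hright : e = SDir.right → above ≠ []) :
      Step M (q, u, γ ++ [Z], above)
        (q', if d then u.tail else u, (moveStack e γ Z above).1, (moveStack e γ Z above).2)

/-- Acceptance: from (q₀, w▷, Z₀↑$) reach a final state with the whole input read. -/
def Accepts {T : Type} (M : SA T) (w : List T) : Prop :=
  ∃ (qf : M.Q) (g1 g2 : List M.Γ), qf ∈ M.F ∧
    Relation.ReflTransGen (Step M) (M.q0, w, [M.Z0], []) (qf, [], g1, g2)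

/-- The language of a stack automaton. -/
def lang {T : Type} (M : SA T) : Set (List T) := {w | M.Accepts w}

/-- Nonerasing: every pushdown-mode transition pushes a nonempty word. -/
def NonErasing {T : Type} (M : SA T) : Prop :=
  ∀ q a Z q' d y, (q', d, y) ∈ M.push q a Z → y ≠ []

end SA

/-- Scan a string for the brackets of index `i`, starting inside (`true`) or outside (`false`)
a group; fails with `none` when an opening bracket is met inside or a closing one outside. -/
def bracketScan {A : Type} (i : ℕ+) : Bool → List (RSym A) → Option Bool
  | b, [] => some b
  | b, .open_ j :: v =>
      if j = i then (if b then none else bracketScan i true v) else bracketScan i b v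
  | b, .close j :: v =>
      if j = i then (if b then bracketScan i false v else none) else bracketScan i b v
  | b, .ch _ :: v => bracketScan i b v
  | b, .ref _ :: v => bracketScan i b v

theorem bracketScan_append {A : Type} (i : ℕ+) (b : Bool) (u v : List (RSym A)) :
    bracketScan i b (u ++ v) = (bracketScan i b u).bind fun c => bracketScan i c v := by
  induction u generalizing b with
  | nil => rfl
  | cons c u ih =>
    cases c <;> simp only [List.cons_append, bracketScan, ih] <;> split_ifs <;> rfl

theorem bracketScan_of_notMem {A : Type} {i : ℕ+} {u : List (RSym A)}
    (ho : RSym.open_ i ∉ u) (hc : RSym.close i ∉ u) (b : Bool) :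
    bracketScan i b u = some b := by
  induction u with
  | nil => rfl
  | cons c u ih =>
    simp only [List.mem_cons, not_or] at ho hc
    cases c <;> simp_all [bracketScan, eq_comm]

theorem notMem_of_mem_ref {A : Type} {i : ℕ+} {α : Rewb A} (hα : ¬ hasIdx i α)
    {w : List (RSym A)} (hw : w ∈ Ref α) : RSym.open_ i ∉ w ∧ RSym.close i ∉ w := by
  induction α generalizing w with
  | ch a => obtain rfl : w = [RSym.ch a] := hw; simp
  | eps => obtain rfl : w = [] := hw; simp
  | backref j => obtain rfl : w = [RSym.ref j] := hw; simp
  | cat r s ihr ihs =>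
    simp only [hasIdx, not_or] at hα
    obtain ⟨u, hu, v, hv, rfl⟩ := Language.mem_mul.1 hw
    have := ihr hα.1 hu
    have := ihs hα.2 hv
    simp_all
  | alt r s ihr ihs =>
    simp only [hasIdx, not_or] at hα
    exact hw.elim (ihr hα.1) (ihs hα.2)
  | star r ih =>
    obtain ⟨L, rfl, hL⟩ := Language.mem_kstar.1 hw
    simp only [List.mem_flatten, not_exists, not_and]
    exact ⟨fun y hy => (ih hα (hL y hy)).1, fun y hy => (ih hα (hL y hy)).2⟩
  | grp j r ih =>
    simp only [hasIdx, not_or] at hα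
    obtain ⟨u, hu, v, rfl, rfl⟩ := Language.mem_mul.1 hw
    obtain ⟨t, rfl, x, hx, rfl⟩ := Language.mem_mul.1 hu
    have := ih hα.2 hx
    simp_all [eq_comm]

theorem bracketScan_of_mem_ref {A : Type} (i : ℕ+) {α : Rewb A} (hα : α.WF)
    {w : List (RSym A)} (hw : w ∈ Ref α) : bracketScan i false w = some false := by
  induction α generalizing w with
  | ch a => obtain rfl : w = [RSym.ch a] := hw; rfl
  | eps => obtain rfl : w = [] := hw; rfl
  | backref j => obtain rfl : w = [RSym.ref j] := hw; rfl
  | cat r s ihr ihs =>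
    obtain ⟨u, hu, v, hv, rfl⟩ := Language.mem_mul.1 hw
    rw [bracketScan_append, ihr hα.1 hu]
    exact ihs hα.2 hv
  | alt r s ihr ihs => exact hw.elim (ihr hα.1) (ihs hα.2)
  | star r ih =>
    obtain ⟨L, rfl, hL⟩ := Language.mem_kstar.1 hw
    clear hw
    induction L with
    | nil => rfl
    | cons y L ihL =>
      rw [List.flatten_cons, bracketScan_append, ih hα (hL y List.mem_cons_self)]
      exact ihL fun z hz => hL z (List.mem_cons_of_mem _ hz)
  | grp j r ih =>
    obtain ⟨u, hu, v, rfl, rfl⟩ := Language.mem_mul.1 hw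
    obtain ⟨t, rfl, x, hx, rfl⟩ := Language.mem_mul.1 hu
    by_cases hj : j = i
    · subst hj
      have hfree := notMem_of_mem_ref hα.2 hx
      simp [bracketScan, bracketScan_append, bracketScan_of_notMem hfree.1 hfree.2]
    · simp [bracketScan, bracketScan_append, ih hα.1 hx, hj]

theorem bracket_alternates_of_bracketScan_ne_none {A : Type} {i : ℕ+} {b : Bool}
    {ps : List (RSym A × List (RSym A))}
    (hps : ∀ q ∈ ps, (RSym.open_ i ∉ q.2 ∧ RSym.close i ∉ q.2) ∧
      (q.1 = RSym.open_ i ∨ q.1 = RSym.close i))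
    (hscan : bracketScan i b (ps.map fun q => q.1 :: q.2).flatten ≠ none)
    (r : ℕ) (h : r < ps.length) :
    ps[r].1 = if (r + b.toNat) % 2 = 0 then RSym.open_ i else RSym.close i := by
  induction ps generalizing b r with
  | nil => simp at h
  | cons q ps ih =>
    obtain ⟨c, x⟩ := q
    obtain ⟨⟨ho, hc⟩, hb⟩ := hps _ List.mem_cons_self
    have htail := fun q hq => hps q (List.mem_cons_of_mem _ hq)
    simp only at ho hc hb
    have hstep : (c = if b then RSym.close i else RSym.open_ i) ∧
        bracketScan i (!b) (ps.map fun q => q.1 :: q.2).flatten ≠ none := by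
      rcases hb with rfl | rfl <;> cases b <;>
        simpa [bracketScan, bracketScan_append, bracketScan_of_notMem ho hc] using hscan
    cases r with
    | zero => cases b <;> simpa using hstep.1
    | succ r =>
      have key := ih htail hstep.2 r (by simpa using h)
      rw [List.getElem_cons_succ, key]
      congr 1
      cases b <;> simp [add_assoc]

/-- Corollary prefixdyck. -/
theorem stmt3 {A : Type} (α : Rewb A) (hwf : α.WF) (i : ℕ+)
    (w : List (RSym A)) (hw : w ∈ Ref α) (p : List (RSym A)) (hp : p <+: w)
    (x0 : List (RSym A)) (ps : List (RSym A × List (RSym A)))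
    (hdec : p = x0 ++ (ps.map fun q => q.1 :: q.2).flatten)
    (hx0 : RSym.open_ i ∉ x0 ∧ RSym.close i ∉ x0)
    (hps : ∀ q ∈ ps, (RSym.open_ i ∉ q.2 ∧ RSym.close i ∉ q.2) ∧
      (q.1 = RSym.open_ i ∨ q.1 = RSym.close i)) :
    ∀ (r : ℕ) (h : r < ps.length),
      (ps.get ⟨r, h⟩).1 = if r % 2 = 0 then RSym.open_ i else RSym.close i := by
  intro r h
  subst hdec
  obtain ⟨v, rfl⟩ := hp
  have hscan := bracketScan_of_mem_ref i hwf hw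
  rw [bracketScan_append, bracketScan_append, bracketScan_of_notMem hx0.1 hx0.2] at hscan
  simpa using bracket_alternates_of_bracketScan_ne_none (b := false) hps
    (fun hnone => by simp [hnone] at hscan) r h

end Rewbs
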